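/- For every integer m ≥ 1 and all reals θ > 0, a > −1, the average von Neumann entropy over the quantum interpolating ensemble satisfies E_f[−Σ_{i=1}^m λ_i ln λ_i] = ψ₀(d+1) − (1/d) · E_h[Σ_{i=1}^m x_i ln x_i]. -/

import Mathlib

open Finset MeasureTheory Set

noncomputable section

/-- The unconstrained interpolating weight on `[0,∞)^m`:
`h̃(x) = ∏_{i<j} ((x_i−x_j)/(x_i+x_j))·(x_i^θ−x_j^θ) · ∏_i x_i^a e^{−x_i}`. -/
def hWeight (m : ℕ) (θ a : ℝ) (x : Fin m → ℝ) : ℝ :=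
  (∏ p ∈ Finset.univ.filter (fun p : Fin m × Fin m => p.1 < p.2),
      ((x p.1 - x p.2) / (x p.1 + x p.2) * (x p.1 ^ θ - x p.2 ^ θ)))
    * ∏ i, x i ^ a * Real.exp (-(x i))

/-- The positive orthant `[0,∞)^m`. -/
def orthant (m : ℕ) : Set (Fin m → ℝ) := {x | ∀ i, 0 ≤ x i}

/-- The unconstrained average
`E_h[G] = (∫_{[0,∞)^m} G h̃)/(∫_{[0,∞)^m} h̃)`. -/
def Eh (m : ℕ) (θ a : ℝ) (G : (Fin m → ℝ) → ℝ) : ℝ :=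
  (∫ x in orthant m, G x * hWeight m θ a x) / (∫ x in orthant m, hWeight m θ a x)

/-- The density (up to normalization) of the quantum interpolating ensemble:
`Ṽ(λ) = ∏_{i<j} ((λ_i−λ_j)/(λ_i+λ_j))·(λ_i^θ−λ_j^θ) · ∏_i λ_i^a`. -/
def Vdens (m : ℕ) (θ a : ℝ) (lam : Fin m → ℝ) : ℝ :=
  (∏ p ∈ Finset.univ.filter (fun p : Fin m × Fin m => p.1 < p.2),
      ((lam p.1 - lam p.2) / (lam p.1 + lam p.2) * (lam p.1 ^ θ - lam p.2 ^ θ)))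
    * ∏ i, lam i ^ a

/-- Parametrization of the probability simplex: the first `m−1` coordinates
are free and the last one is `1 −` their sum. -/
def simplexExt (m : ℕ) (lam : Fin (m - 1) → ℝ) : Fin m → ℝ :=
  fun i => if h : (i : ℕ) < m - 1 then lam ⟨i, h⟩ else 1 - ∑ j, lam j

/-- The parameter domain `Δ = {λ ∈ [0,∞)^{m−1} : Σ λ_i ≤ 1}` of the simplex. -/
def simplexDom (m : ℕ) : Set (Fin (m - 1) → ℝ) :=
  {lam | (∀ i, 0 ≤ lam i) ∧ ∑ i, lam i ≤ 1}

/-- The constrained average over the quantum interpolating ensemble: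
`E_f[G] = (∫_Δ G(λ) Ṽ(λ) dλ)/(∫_Δ Ṽ(λ) dλ)`, where `λ` runs over the simplex
parametrized by its first `m−1` coordinates. -/
def Ef (m : ℕ) (θ a : ℝ) (G : (Fin m → ℝ) → ℝ) : ℝ :=
  (∫ l in simplexDom m, G (simplexExt m l) * Vdens m θ a (simplexExt m l))
    / (∫ l in simplexDom m, Vdens m θ a (simplexExt m l))

/-- The parameter `d = m(mθ − θ + 2a + 2)/2`. -/
def dPar (m : ℕ) (θ a : ℝ) : ℝ := m * (m * θ - θ + 2 * a + 2) / 2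

/-- The digamma function `ψ₀ = Γ'/Γ`. -/
def psi0 (x : ℝ) : ℝ := deriv Real.Gamma x / Real.Gamma x

theorem integrableOn_rpow_mul_log_mul_exp_and_integral_eq {s : ℝ} (hs : 0 < s) :
    IntegrableOn (fun t : ℝ => t ^ (s - 1) * Real.log t * Real.exp (-t)) (Ioi 0) ∧
      ∫ t in Ioi (0 : ℝ), t ^ (s - 1) * Real.log t * Real.exp (-t) = deriv Real.Gamma s := by
  have key : MellinConvergent (fun t : ℝ => Real.log t • ((Real.exp (-t) : ℝ) : ℂ)) (s : ℂ) ∧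
      HasDerivAt (mellin fun t : ℝ => ((Real.exp (-t) : ℝ) : ℂ))
        (mellin (fun t : ℝ => Real.log t • ((Real.exp (-t) : ℝ) : ℂ)) s) s := by
    refine mellin_hasDerivAt_of_isBigO_rpow (a := s + 1) (b := 0) ?_ ?_ ?_ ?_ ?_
    · refine (Continuous.continuousOn ?_).locallyIntegrableOn measurableSet_Ioi
      exact Complex.continuous_ofReal.comp (Real.continuous_exp.comp continuous_neg)
    · rw [← Asymptotics.isBigO_norm_left]
      simp_rw [Complex.norm_real, Asymptotics.isBigO_norm_left]
      simpa only [neg_one_mul] using (isLittleO_exp_neg_mul_rpow_atTop zero_lt_one _).isBigO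
    · simp
    · simp_rw [neg_zero, Real.rpow_zero]
      refine Asymptotics.isBigO_const_of_tendsto
        (?_ : Filter.Tendsto _ _ (nhds (1 : ℂ))) one_ne_zero
      rw [(by simp : (1 : ℂ) = Real.exp (-0))]
      exact (Complex.continuous_ofReal.comp
        (Real.continuous_exp.comp continuous_neg)).continuousWithinAt
    · simpa using hs
  have hpt : ∀ t ∈ Ioi (0 : ℝ), (t : ℂ) ^ ((s : ℂ) - 1) • (Real.log t • ((Real.exp (-t) : ℝ) : ℂ))
      = ((t ^ (s - 1) * Real.log t * Real.exp (-t) : ℝ) : ℂ) := by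
    intro t ht
    have : (t : ℂ) ^ ((s : ℂ) - 1) = ((t ^ (s - 1) : ℝ) : ℂ) := by
      rw [Complex.ofReal_cpow (le_of_lt ht)]; push_cast; rfl
    rw [this, Complex.real_smul, smul_eq_mul, mul_assoc]
    push_cast; ring
  obtain ⟨hc, hd⟩ := key
  have hint : IntegrableOn (fun t : ℝ => ((t ^ (s - 1) * Real.log t * Real.exp (-t) : ℝ) : ℂ))
      (Ioi 0) := (integrableOn_congr_fun hpt measurableSet_Ioi).1 hc
  refine ⟨hint.re, ?_⟩
  have hm : mellin (fun t : ℝ => Real.log t • ((Real.exp (-t) : ℝ) : ℂ)) s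
      = ((∫ t in Ioi (0 : ℝ), t ^ (s - 1) * Real.log t * Real.exp (-t) : ℝ) : ℂ) := by
    rw [mellin, setIntegral_congr_fun measurableSet_Ioi hpt]
    exact integral_ofReal
  rw [hm, ← Complex.GammaIntegral_eq_mellin] at hd
  have hd' := hd.real_of_complex
  rw [Complex.ofReal_re] at hd'
  refine (HasDerivAt.deriv (hd'.congr_of_eventuallyEq ?_)).symm
  filter_upwards [Ioi_mem_nhds hs] with u hu
  rw [Real.Gamma, Complex.Gamma_eq_integral (by simpa using hu)]
open scoped ENNReal

theorem measurableSet_orthant (m : ℕ) : MeasurableSet (orthant m) := by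
  simp only [orthant, ofPred_forall]
  exact .iInter fun i => measurableSet_le measurable_const (measurable_pi_apply i)

theorem measurableSet_simplexDom (m : ℕ) : MeasurableSet (simplexDom m) := by
  have h : simplexDom m = orthant (m - 1) ∩ {l | ∑ i, l i ≤ 1} := rfl
  rw [h]
  exact (measurableSet_orthant _).inter
    (measurableSet_le (by fun_prop) measurable_const)

theorem measurable_simplexExt (m : ℕ) : Measurable (simplexExt m) := by
  refine measurable_pi_lambda _ fun i => ?_
  unfold simplexExt
  split_ifs <;> fun_prop

theorem simplexExt_succ (n : ℕ) (l : Fin n → ℝ) :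
    simplexExt (n + 1) l = Fin.snoc (α := fun _ => ℝ) l (1 - ∑ j, l j) := by
  funext i
  refine Fin.lastCases ?_ (fun j => ?_) i
  · simp [simplexExt]
  · simp [simplexExt]

theorem sum_simplexExt (n : ℕ) (l : Fin n → ℝ) : ∑ i, simplexExt (n + 1) l i = 1 := by
  rw [simplexExt_succ, Fin.sum_univ_castSucc]
  simp

theorem simplexExt_mem_orthant {n : ℕ} {l : Fin n → ℝ} :
    simplexExt (n + 1) l ∈ orthant (n + 1) ↔ l ∈ simplexDom (n + 1) := by
  rw [simplexExt_succ]
  simp only [orthant, simplexDom, mem_ofPred_eq, Fin.forall_fin_succ', Fin.snoc_castSucc,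
    Fin.snoc_last, sub_nonneg]
  rfl

theorem smul_mem_orthant {m : ℕ} {r : ℝ} (hr : 0 < r) {x : Fin m → ℝ} :
    r • x ∈ orthant m ↔ x ∈ orthant m := by
  simp [orthant, mul_nonneg_iff_of_pos_left hr]

theorem lintegral_smul_eq {n : ℕ} {r : ℝ} (hr : 0 < r) (f : (Fin n → ℝ) → ℝ≥0∞) :
    ∫⁻ y, f y = ENNReal.ofReal (r ^ n) * ∫⁻ y, f (r • y) := by
  have h := Measure.map_addHaar_smul (volume : Measure (Fin n → ℝ)) hr.ne'
  have h2 : ∫⁻ y, f (r • y) = ∫⁻ y, f y ∂(Measure.map (fun x : Fin n → ℝ => r • x) volume) :=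
    (lintegral_map_equiv f (MeasurableEquiv.smul₀ r hr.ne')).symm
  rw [h2, h, lintegral_smul_measure, smul_eq_mul, ← mul_assoc, ← ENNReal.ofReal_mul (by positivity),
    Module.finrank_fin_fun, abs_of_nonneg (by positivity), mul_inv_cancel₀ (by positivity)]
  simp

/-- Polar-type decomposition of the orthant along the simplex `∑ xᵢ = r`. -/
theorem lintegral_orthant (n : ℕ) {F : (Fin (n + 1) → ℝ) → ℝ≥0∞} (hF : Measurable F) :
    ∫⁻ x in orthant (n + 1), F x =
      ∫⁻ r in Ioi (0 : ℝ), ENNReal.ofReal (r ^ n) *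
        ∫⁻ l in simplexDom (n + 1), F (r • simplexExt (n + 1) l) := by
  set G := (orthant (n + 1)).indicator F with hG
  have hGm : Measurable G := hF.indicator (measurableSet_orthant _)
  have hsnoc : Measurable fun p : (Fin n → ℝ) × ℝ =>
      (Fin.snoc (α := fun _ => ℝ) p.1 p.2 : Fin (n + 1) → ℝ) := by
    refine measurable_pi_lambda _ fun i => ?_
    refine Fin.lastCases ?_ (fun j => ?_) i
    · simpa using measurable_snd
    · simp only [Fin.snoc_castSucc]; fun_prop
  have e1 : ∫⁻ x in orthant (n + 1), F x
      = ∫⁻ y : Fin n → ℝ, ∫⁻ t : ℝ, G (Fin.snoc (α := fun _ => ℝ) y t) := by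
    rw [← lintegral_indicator (measurableSet_orthant _), ← hG]
    have hp := (volume_preserving_piFinSuccAbove (fun _ : Fin (n + 1) => ℝ) (Fin.last n)).symm
    rw [← hp.lintegral_comp hGm, Measure.volume_eq_prod]
    refine (lintegral_prod_symm' _ (hGm.comp (MeasurableEquiv.measurable _))).trans ?_
    simp [MeasurableEquiv.piFinSuccAbove_symm_apply, Fin.insertNthEquiv, Fin.insertNth_last']
  have e2 : ∀ y : Fin n → ℝ, ∫⁻ t : ℝ, G (Fin.snoc (α := fun _ => ℝ) y t)
      = ∫⁻ s : ℝ, G (Fin.snoc (α := fun _ => ℝ) y (s - ∑ i, y i)) := fun y =>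
    (lintegral_sub_right_eq_self (fun t => G (Fin.snoc (α := fun _ => ℝ) y t)) (∑ i, y i)).symm
  have hmeas : Measurable (Function.uncurry fun (y : Fin n → ℝ) (s : ℝ) =>
      G (Fin.snoc (α := fun _ => ℝ) y (s - ∑ i, y i))) :=
    hGm.comp (hsnoc.comp (measurable_fst.prodMk (by fun_prop)))
  rw [e1, lintegral_congr e2, lintegral_lintegral_swap hmeas.aemeasurable,
    ← lintegral_indicator measurableSet_Ioi]
  refine lintegral_congr_ae ?_
  filter_upwards [Measure.ae_ne volume (0 : ℝ)] with s hs0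
  rcases lt_or_gt_of_ne hs0 with hs | hs
  · rw [indicator_of_notMem (by simpa using hs.le), lintegral_eq_zero_of_ae_eq_zero]
    refine Filter.Eventually.of_forall fun y => ?_
    refine indicator_of_notMem (fun hy => ?_) _
    have : 0 ≤ ∑ i, (Fin.snoc (α := fun _ => ℝ) y (s - ∑ i, y i) : Fin (n + 1) → ℝ) i :=
      Finset.sum_nonneg fun i _ => hy i
    rw [Fin.sum_univ_castSucc] at this
    simp at this
    linarith
  · rw [indicator_of_mem (by simpa using hs), lintegral_smul_eq hs,
      ← lintegral_indicator (measurableSet_simplexDom _)]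
    congr 1
    refine lintegral_congr fun l => ?_
    have hx : (Fin.snoc (α := fun _ => ℝ) (s • l) (s - ∑ i, (s • l) i) : Fin (n + 1) → ℝ)
        = s • simplexExt (n + 1) l := by
      rw [simplexExt_succ]
      funext i
      refine Fin.lastCases ?_ (fun j => ?_) i
      · simp [mul_sub, Finset.mul_sum]
      · simp
    rw [hx]
    by_cases hl : l ∈ simplexDom (n + 1)
    · rw [indicator_of_mem hl, hG, indicator_of_mem]
      exact (smul_mem_orthant hs).2 (simplexExt_mem_orthant.2 hl)
    · rw [indicator_of_notMem hl, hG, indicator_of_notMem]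
      rwa [smul_mem_orthant hs, simplexExt_mem_orthant]

/-- The radial measure `r ^ n dr` on `(0,∞)`. -/
def radialMeasure (n : ℕ) : Measure ℝ :=
  (volume.restrict (Ioi 0)).withDensity fun r => ENNReal.ofReal (r ^ n)

instance (n : ℕ) : SFinite (radialMeasure n) := by unfold radialMeasure; infer_instance

theorem measurable_coneMap (n : ℕ) :
    Measurable fun p : ℝ × (Fin n → ℝ) => p.1 • simplexExt (n + 1) p.2 :=
  measurable_fst.smul ((measurable_simplexExt (n + 1)).comp measurable_snd)

theorem map_coneMap (n : ℕ) :
    Measure.map (fun p : ℝ × (Fin n → ℝ) => p.1 • simplexExt (n + 1) p.2)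
      ((radialMeasure n).prod (volume.restrict (simplexDom (n + 1))))
      = volume.restrict (orthant (n + 1)) := by
  refine Measure.ext_of_lintegral _ fun F hF => ?_
  rw [lintegral_map hF (measurable_coneMap n), lintegral_orthant n hF]
  refine (lintegral_prod _ (hF.comp (measurable_coneMap n)).aemeasurable).trans ?_
  rw [radialMeasure, lintegral_withDensity_eq_lintegral_mul _ (by fun_prop)]
  · rfl
  · exact (hF.comp (measurable_coneMap n)).lintegral_prod_right'

theorem integrable_radialMeasure {n : ℕ} {f : ℝ → ℝ} :
    Integrable f (radialMeasure n) ↔ IntegrableOn (fun r => r ^ n * f r) (Ioi 0) := by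
  unfold radialMeasure
  rw [integrable_withDensity_iff_integrable_smul' (by fun_prop) (by simp)]
  refine integrableOn_congr_fun (fun r hr => ?_) measurableSet_Ioi
  have : (0 : ℝ) ≤ r ^ n := pow_nonneg (le_of_lt hr) n
  simp [ENNReal.toReal_ofReal this]

theorem integral_radialMeasure {n : ℕ} (f : ℝ → ℝ) :
    ∫ r, f r ∂(radialMeasure n) = ∫ r in Ioi 0, r ^ n * f r := by
  unfold radialMeasure
  rw [integral_withDensity_eq_integral_toReal_smul (by fun_prop) (by simp)]
  refine setIntegral_congr_fun measurableSet_Ioi (fun r hr => ?_)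
  have : (0 : ℝ) ≤ r ^ n := pow_nonneg (le_of_lt hr) n
  simp [ENNReal.toReal_ofReal this]
theorem card_filter_fst_lt_snd (m : ℕ) :
    ((Finset.univ.filter fun p : Fin m × Fin m => p.1 < p.2).card : ℝ) = m * (m - 1) / 2 := by
  have h : (Finset.univ.filter fun p : Fin m × Fin m => p.1 < p.2).card
      = ∑ j ∈ Finset.range m, j := by
    rw [Finset.card_filter, Fintype.sum_prod_type_right, ← Fin.sum_univ_eq_sum_range]
    refine Finset.sum_congr rfl fun j _ => ?_
    rw [← Finset.card_filter, ← Fin.card_Iio j]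
    congr 1
    ext i
    simp
  have h2 := Finset.sum_range_id_mul_two m
  rw [h]
  rcases m with _ | k
  · simp
  · have : ((∑ i ∈ Finset.range (k + 1), i : ℕ) : ℝ) * 2 = (k + 1) * k := by
      exact_mod_cast h2
    push_cast at this ⊢
    linarith

theorem hWeight_eq (m : ℕ) (θ a : ℝ) (x : Fin m → ℝ) :
    hWeight m θ a x = Real.exp (-∑ i, x i) * Vdens m θ a x := by
  rw [hWeight, Vdens, Finset.prod_mul_distrib (f := fun i => x i ^ a), ← Real.exp_sum,
    Finset.sum_neg_distrib]
  ring

theorem Vdens_smul {m : ℕ} (θ a : ℝ) {r : ℝ} (hr : 0 < r) {x : Fin m → ℝ} (hx : x ∈ orthant m) :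
    Vdens m θ a (r • x) = r ^ (dPar m θ a - m) * Vdens m θ a x := by
  have e1 : ∀ p : Fin m × Fin m,
      ((r • x) p.1 - (r • x) p.2) / ((r • x) p.1 + (r • x) p.2)
        * ((r • x) p.1 ^ θ - (r • x) p.2 ^ θ)
      = r ^ θ * ((x p.1 - x p.2) / (x p.1 + x p.2) * (x p.1 ^ θ - x p.2 ^ θ)) := by
    intro p
    simp only [Pi.smul_apply, smul_eq_mul]
    rw [Real.mul_rpow hr.le (hx _), Real.mul_rpow hr.le (hx _), ← mul_sub, ← mul_add,
      mul_div_mul_left _ _ hr.ne']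
    ring
  have e2 : ∀ i, (r • x) i ^ a = r ^ a * x i ^ a := fun i => by
    simp only [Pi.smul_apply, smul_eq_mul]
    rw [Real.mul_rpow hr.le (hx _)]
  unfold Vdens
  simp only [e1, e2, Finset.prod_mul_distrib, Finset.prod_const, Finset.card_univ,
    Fintype.card_fin]
  have e3 : r ^ (dPar m θ a - m)
      = (r ^ θ) ^ (Finset.univ.filter fun p : Fin m × Fin m => p.1 < p.2).card * (r ^ a) ^ m := by
    rw [← Real.rpow_mul_natCast hr.le, ← Real.rpow_mul_natCast hr.le, ← Real.rpow_add hr,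
      card_filter_fst_lt_snd]
    congr 1
    unfold dPar
    ring
  rw [e3]
  ring

theorem measurable_Vdens (m : ℕ) (θ a : ℝ) : Measurable (Vdens m θ a) := by
  unfold Vdens
  fun_prop

theorem measurable_hWeight (m : ℕ) (θ a : ℝ) : Measurable (hWeight m θ a) := by
  unfold hWeight
  fun_prop

theorem interpolating_factor_nonneg {θ u v : ℝ} (hθ : 0 < θ) (hu : 0 ≤ u) (hv : 0 ≤ v) :
    0 ≤ (u - v) / (u + v) * (u ^ θ - v ^ θ) := by
  rcases le_total u v with h | h
  · exact mul_nonneg_of_nonpos_of_nonpos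
      (div_nonpos_of_nonpos_of_nonneg (by linarith) (by linarith))
      (sub_nonpos.2 (Real.rpow_le_rpow hu h hθ.le))
  · exact mul_nonneg (div_nonneg (by linarith) (by linarith))
      (sub_nonneg.2 (Real.rpow_le_rpow hv h hθ.le))

theorem interpolating_factor_pos {θ u v : ℝ} (hθ : 0 < θ) (hu : 0 < u) (huv : u < v) :
    0 < (u - v) / (u + v) * (u ^ θ - v ^ θ) :=
  mul_pos_of_neg_of_neg (div_neg_of_neg_of_pos (by linarith) (by linarith))
    (sub_neg.2 (Real.rpow_lt_rpow hu.le huv hθ))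

theorem interpolating_factor_le {θ u v : ℝ} (hu : 0 ≤ u) (hv : 0 ≤ v) :
    (u - v) / (u + v) * (u ^ θ - v ^ θ) ≤ (1 + u ^ θ) * (1 + v ^ θ) := by
  have h1 : |(u - v) / (u + v)| ≤ 1 := by
    rw [abs_div, abs_of_nonneg (add_nonneg hu hv)]
    exact div_le_one_of_le₀ (abs_le.2 ⟨by linarith, by linarith⟩) (by linarith)
  have hu' := Real.rpow_nonneg hu θ
  have hv' := Real.rpow_nonneg hv θ
  have h2 : |u ^ θ - v ^ θ| ≤ (1 + u ^ θ) * (1 + v ^ θ) := by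
    have := mul_nonneg hu' hv'
    exact abs_le.2 ⟨by nlinarith, by nlinarith⟩
  calc (u - v) / (u + v) * (u ^ θ - v ^ θ) ≤ |(u - v) / (u + v) * (u ^ θ - v ^ θ)| := le_abs_self _
    _ = |(u - v) / (u + v)| * |u ^ θ - v ^ θ| := abs_mul _ _
    _ ≤ 1 * |u ^ θ - v ^ θ| := by gcongr
    _ ≤ _ := by simpa using h2

theorem Vdens_nonneg {m : ℕ} {θ a : ℝ} (hθ : 0 < θ) {x : Fin m → ℝ} (hx : x ∈ orthant m) :
    0 ≤ Vdens m θ a x :=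
  mul_nonneg (Finset.prod_nonneg fun _ _ => interpolating_factor_nonneg hθ (hx _) (hx _))
    (Finset.prod_nonneg fun _ _ => Real.rpow_nonneg (hx _) _)

theorem hWeight_nonneg {m : ℕ} {θ a : ℝ} (hθ : 0 < θ) {x : Fin m → ℝ} (hx : x ∈ orthant m) :
    0 ≤ hWeight m θ a x := by
  rw [hWeight_eq]
  exact mul_nonneg (Real.exp_pos _).le (Vdens_nonneg hθ hx)

theorem hWeight_le {m : ℕ} {θ a : ℝ} (hθ : 0 < θ) {x : Fin m → ℝ} (hx : x ∈ orthant m) :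
    hWeight m θ a x ≤ ∏ i, (1 + x i ^ θ) ^ (2 * m) * (x i ^ a * Real.exp (-(x i))) := by
  have h1 : ∀ i, 1 ≤ 1 + x i ^ θ := fun i => by linarith [Real.rpow_nonneg (hx i) θ]
  unfold hWeight
  rw [Finset.prod_mul_distrib (f := fun i => (1 + x i ^ θ) ^ (2 * m))]
  refine mul_le_mul_of_nonneg_right ?_ (Finset.prod_nonneg fun i _ =>
    mul_nonneg (Real.rpow_nonneg (hx i) _) (Real.exp_pos _).le)
  calc _ ≤ ∏ p ∈ Finset.univ.filter (fun p : Fin m × Fin m => p.1 < p.2),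
          (1 + x p.1 ^ θ) * (1 + x p.2 ^ θ) :=
        Finset.prod_le_prod (fun _ _ => interpolating_factor_nonneg hθ (hx _) (hx _))
          fun _ _ => interpolating_factor_le (hx _) (hx _)
    _ ≤ ∏ p : Fin m × Fin m, (1 + x p.1 ^ θ) * (1 + x p.2 ^ θ) :=
        Finset.prod_le_prod_of_subset_of_one_le (Finset.filter_subset _ _)
          (fun p _ => mul_nonneg (by linarith [h1 p.1]) (by linarith [h1 p.2]))
          fun p _ _ => one_le_mul_of_one_le_of_one_le (h1 _) (h1 _)
    _ = ∏ i, (1 + x i ^ θ) ^ (2 * m) := by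
        rw [Finset.prod_mul_distrib, Fintype.prod_prod_type, Fintype.prod_prod_type]
        simp only [Finset.prod_const, Finset.card_univ, Fintype.card_fin]
        rw [Finset.prod_pow, ← pow_add, ← two_mul, Finset.prod_pow]

theorem integrableOn_one_add_rpow_pow_mul {θ a : ℝ} (hθ : 0 < θ) (ha : -1 < a) (N : ℕ) :
    IntegrableOn (fun t : ℝ => (1 + t ^ θ) ^ N * (t ^ a * Real.exp (-t))) (Ici 0) := by
  rw [integrableOn_Ici_iff_integrableOn_Ioi]
  have h : ∀ k ∈ Finset.range (N + 1), IntegrableOn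
      (fun t : ℝ => (N.choose k : ℝ) * (Real.exp (-t) * t ^ (θ * k + a + 1 - 1))) (Ioi 0) :=
    fun k _ => (Real.GammaIntegral_convergent (by
      have : (0 : ℝ) ≤ θ * k := by positivity
      linarith)).const_mul _
  refine (integrableOn_congr_fun (fun t ht => ?_) measurableSet_Ioi).1 (integrable_finsetSum _ h)
  have ht' : (0 : ℝ) < t := ht
  rw [add_comm (1 : ℝ), add_pow, Finset.sum_mul]
  refine Finset.sum_congr rfl fun k _ => ?_
  rw [add_sub_cancel_right, Real.rpow_add ht', Real.rpow_mul_natCast ht'.le]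
  ring

theorem integrableOn_hWeight {m : ℕ} {θ a : ℝ} (hθ : 0 < θ) (ha : -1 < a) :
    IntegrableOn (hWeight m θ a) (orthant m) := by
  have ho : orthant m = Set.pi univ fun _ => Ici (0 : ℝ) := by
    ext x; simp only [orthant, mem_ofPred_eq, Set.mem_pi, mem_univ, true_imp_iff, Set.mem_Ici]
  have hb : IntegrableOn (fun x : Fin m → ℝ =>
      ∏ i, (1 + x i ^ θ) ^ (2 * m) * (x i ^ a * Real.exp (-(x i)))) (orthant m) := by
    rw [IntegrableOn, ho, volume_pi, Measure.restrict_pi_pi]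
    exact Integrable.fintype_prod fun _ => integrableOn_one_add_rpow_pow_mul hθ ha (2 * m)
  refine hb.mono' (measurable_hWeight m θ a).aestronglyMeasurable ?_
  filter_upwards [ae_restrict_mem (measurableSet_orthant m)] with x hx
  rw [Real.norm_of_nonneg (hWeight_nonneg hθ hx)]
  exact hWeight_le hθ hx

theorem hWeight_pos {m : ℕ} {θ a : ℝ} (hθ : 0 < θ) {x : Fin m → ℝ} (hx : ∀ i, 0 < x i)
    (hmono : StrictMono x) : 0 < hWeight m θ a x :=
  mul_pos (Finset.prod_pos fun _ hp =>
      interpolating_factor_pos hθ (hx _) (hmono (Finset.mem_filter.1 hp).2))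
    (Finset.prod_pos fun i _ => mul_pos (Real.rpow_pos_of_pos (hx i) _) (Real.exp_pos _))

theorem integral_hWeight_pos {m : ℕ} {θ a : ℝ} (hθ : 0 < θ) (ha : -1 < a) :
    0 < ∫ x in orthant m, hWeight m θ a x := by
  have h0 : 0 ≤ᵐ[volume.restrict (orthant m)] hWeight m θ a := by
    filter_upwards [ae_restrict_mem (measurableSet_orthant m)] with x hx using hWeight_nonneg hθ hx
  rw [setIntegral_pos_iff_support_of_nonneg_ae h0 (integrableOn_hWeight hθ ha)]
  set U : Set (Fin m → ℝ) := Set.pi univ fun i => Ioo ((i : ℕ) + 1 : ℝ) ((i : ℕ) + 2 : ℝ) with hU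
  have hUo : IsOpen U := isOpen_set_pi finite_univ fun _ _ => isOpen_Ioo
  have hUn : U.Nonempty := ⟨fun i => (i : ℕ) + 3 / 2, fun i _ => ⟨by linarith, by linarith⟩⟩
  refine (hUo.measure_pos volume hUn).trans_le (measure_mono fun x hx => ?_)
  have hx' : ∀ i : Fin m, ((i : ℕ) + 1 : ℝ) < x i ∧ x i < ((i : ℕ) + 2 : ℝ) := fun i => hx i (mem_univ i)
  have hpos : ∀ i, 0 < x i := fun i => by
    have : (0 : ℝ) ≤ (i : ℕ) := Nat.cast_nonneg _
    linarith [(hx' i).1]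
  refine ⟨(hWeight_pos hθ hpos fun i j hij => ?_).ne', fun i => (hpos i).le⟩
  have : ((i : ℕ) + 1 : ℝ) ≤ (j : ℕ) := by exact_mod_cast Nat.succ_le_of_lt hij
  linarith [(hx' i).2, (hx' j).1]

theorem dPar_pos {m : ℕ} (hm : 1 ≤ m) {θ a : ℝ} (hθ : 0 < θ) (ha : -1 < a) : 0 < dPar m θ a := by
  have h1 : (1 : ℝ) ≤ m := by exact_mod_cast hm
  have h2 : 0 < m * θ - θ + 2 * a + 2 := by nlinarith
  unfold dPar
  positivity

theorem abs_sum_mul_log_le {m : ℕ} {x : Fin m → ℝ} (hx : ∀ i, 0 ≤ x i) (hx1 : ∀ i, x i ≤ 1) :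
    |∑ i, x i * Real.log (x i)| ≤ m := by
  refine (Finset.abs_sum_le_sum_abs _ _).trans ?_
  calc ∑ i, |x i * Real.log (x i)| ≤ ∑ _i : Fin m, (1 : ℝ) := by
        refine Finset.sum_le_sum fun i _ => ?_
        rcases (hx i).eq_or_lt with h | h
        · simp [← h]
        · rw [mul_comm]
          exact (Real.abs_log_mul_self_lt _ h (hx1 i)).le
    _ = m := by simp

theorem sum_smul_mul_log {m : ℕ} {r : ℝ} (hr : 0 < r) {x : Fin m → ℝ} (hx : ∑ i, x i = 1) :
    ∑ i, (r • x) i * Real.log ((r • x) i)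
      = r * Real.log r + r * ∑ i, x i * Real.log (x i) := by
  have : ∀ i, (r • x) i * Real.log ((r • x) i)
      = r * Real.log r * x i + r * (x i * Real.log (x i)) := fun i => by
    simp only [Pi.smul_apply, smul_eq_mul]
    rcases eq_or_ne (x i) 0 with h | h
    · simp [h]
    · rw [Real.log_mul hr.ne' h]; ring
  simp_rw [this, Finset.sum_add_distrib, ← Finset.mul_sum, hx, mul_one]

theorem ae_prod_pos_and_mem (n : ℕ) :
    ∀ᵐ p ∂((radialMeasure n).prod (volume.restrict (simplexDom (n + 1)))),
      0 < p.1 ∧ p.2 ∈ simplexDom (n + 1) := by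
  have h1 : ∀ᵐ r ∂(radialMeasure n), 0 < r :=
    (withDensity_absolutelyContinuous _ _).ae_le (ae_restrict_mem measurableSet_Ioi)
  have h2 : ∀ᵐ l ∂(volume.restrict (simplexDom (n + 1))), l ∈ simplexDom (n + 1) :=
    ae_restrict_mem (measurableSet_simplexDom _)
  exact (Measure.quasiMeasurePreserving_fst.ae h1).and (Measure.quasiMeasurePreserving_snd.ae h2)

theorem hWeight_coneMap {n : ℕ} {θ a r : ℝ} {l : Fin n → ℝ} (hr : 0 < r)
    (hl : l ∈ simplexDom (n + 1)) :
    hWeight (n + 1) θ a (r • simplexExt (n + 1) l)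
      = (r ^ (dPar (n + 1) θ a - (n + 1 : ℕ)) * Real.exp (-r))
        * Vdens (n + 1) θ a (simplexExt (n + 1) l) := by
  have hs : ∑ i, (r • simplexExt (n + 1) l) i = r := by
    simp only [Pi.smul_apply, smul_eq_mul, ← Finset.mul_sum]
    rw [sum_simplexExt, mul_one]
  rw [hWeight_eq, hs, Vdens_smul θ a hr (simplexExt_mem_orthant.2 hl)]
  ring

theorem pow_mul_rpow_dPar_sub {n : ℕ} {r : ℝ} (hr : 0 < r) (D : ℝ) :
    r ^ n * r ^ (D - (n + 1 : ℕ)) = r ^ (D - 1) := by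
  rw [← Real.rpow_natCast, ← Real.rpow_add hr]
  congr 1
  push_cast
  ring

theorem integral_orthant (n : ℕ) {F : (Fin (n + 1) → ℝ) → ℝ} (hF : Measurable F) :
    ∫ x in orthant (n + 1), F x = ∫ p, F (p.1 • simplexExt (n + 1) p.2)
      ∂((radialMeasure n).prod (volume.restrict (simplexDom (n + 1)))) := by
  rw [← map_coneMap]
  exact integral_map (measurable_coneMap n).aemeasurable hF.aestronglyMeasurable

theorem integral_hWeight_eq {n : ℕ} {θ a : ℝ} (hθ : 0 < θ) (ha : -1 < a) :
    ∫ x in orthant (n + 1), hWeight (n + 1) θ a x = Real.Gamma (dPar (n + 1) θ a)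
      * ∫ l in simplexDom (n + 1), Vdens (n + 1) θ a (simplexExt (n + 1) l) := by
  rw [integral_orthant n (measurable_hWeight _ _ _)]
  refine (integral_congr_ae (g := fun p : ℝ × (Fin n → ℝ) =>
    (p.1 ^ (dPar (n + 1) θ a - (n + 1 : ℕ)) * Real.exp (-p.1))
      * Vdens (n + 1) θ a (simplexExt (n + 1) p.2)) ?_).trans ?_
  · filter_upwards [ae_prod_pos_and_mem n] with p hp using hWeight_coneMap hp.1 hp.2
  refine (integral_prod_mul
    (fun r : ℝ => r ^ (dPar (n + 1) θ a - (n + 1 : ℕ)) * Real.exp (-r))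
    (fun l : Fin n → ℝ => Vdens (n + 1) θ a (simplexExt (n + 1) l))).trans ?_
  congr 1
  rw [integral_radialMeasure, Real.Gamma_eq_integral (dPar_pos (by omega) hθ ha)]
  refine setIntegral_congr_fun measurableSet_Ioi fun r hr => ?_
  rw [← mul_assoc, pow_mul_rpow_dPar_sub hr, mul_comm]

theorem integral_Vdens_ne_zero {n : ℕ} {θ a : ℝ} (hθ : 0 < θ) (ha : -1 < a) :
    ∫ l in simplexDom (n + 1), Vdens (n + 1) θ a (simplexExt (n + 1) l) ≠ 0 := by
  have h := integral_hWeight_pos (m := n + 1) hθ ha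
  rw [integral_hWeight_eq hθ ha] at h
  exact right_ne_zero_of_mul h.ne'

theorem integrableOn_Vdens {n : ℕ} {θ a : ℝ} (hθ : 0 < θ) (ha : -1 < a) :
    IntegrableOn (fun l => Vdens (n + 1) θ a (simplexExt (n + 1) l)) (simplexDom (n + 1)) :=
  .of_integral_ne_zero (integral_Vdens_ne_zero hθ ha)

theorem measurable_sum_mul_log (m : ℕ) :
    Measurable fun x : Fin m → ℝ => ∑ i, x i * Real.log (x i) := by
  fun_prop

theorem integrableOn_sum_mul_log_mul_Vdens {n : ℕ} {θ a : ℝ} (hθ : 0 < θ) (ha : -1 < a) :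
    IntegrableOn (fun l => (∑ i, simplexExt (n + 1) l i * Real.log (simplexExt (n + 1) l i))
      * Vdens (n + 1) θ a (simplexExt (n + 1) l)) (simplexDom (n + 1)) := by
  refine (integrableOn_Vdens hθ ha).bdd_mul (c := (n + 1 : ℕ))
    ((measurable_sum_mul_log _).comp (measurable_simplexExt _)).aestronglyMeasurable ?_
  filter_upwards [ae_restrict_mem (measurableSet_simplexDom _)] with l hl
  have h0 := simplexExt_mem_orthant.2 hl
  refine abs_sum_mul_log_le h0 fun i => ?_
  rw [← sum_simplexExt n l]
  exact Finset.single_le_sum (fun j _ => h0 j) (Finset.mem_univ i)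

theorem integral_sum_mul_log_mul_hWeight_eq {n : ℕ} {θ a : ℝ} (hθ : 0 < θ) (ha : -1 < a) :
    ∫ x in orthant (n + 1), (∑ i, x i * Real.log (x i)) * hWeight (n + 1) θ a x
      = deriv Real.Gamma (dPar (n + 1) θ a + 1)
          * (∫ l in simplexDom (n + 1), Vdens (n + 1) θ a (simplexExt (n + 1) l))
        + Real.Gamma (dPar (n + 1) θ a + 1) * ∫ l in simplexDom (n + 1),
          (∑ i, simplexExt (n + 1) l i * Real.log (simplexExt (n + 1) l i))
            * Vdens (n + 1) θ a (simplexExt (n + 1) l) := by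
  set D := dPar (n + 1) θ a with hD
  have hD0 : 0 < D := dPar_pos (by omega) hθ ha
  set f : ℝ → ℝ := fun r => r * Real.log r * (r ^ (D - (n + 1 : ℕ)) * Real.exp (-r)) with hf
  set g : ℝ → ℝ := fun r => r * (r ^ (D - (n + 1 : ℕ)) * Real.exp (-r)) with hg
  set V : (Fin n → ℝ) → ℝ := fun l => Vdens (n + 1) θ a (simplexExt (n + 1) l) with hV
  set W : (Fin n → ℝ) → ℝ := fun l =>
    (∑ i, simplexExt (n + 1) l i * Real.log (simplexExt (n + 1) l i)) * V l with hW
  have hpow : ∀ r ∈ Ioi (0 : ℝ), r ^ n * (r * r ^ (D - (n + 1 : ℕ))) = r ^ (D + 1 - 1) := by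
    intro r hr
    have hr' : (0 : ℝ) < r := hr
    rw [mul_left_comm, pow_mul_rpow_dPar_sub hr', add_sub_cancel_right, Real.rpow_sub_one hr'.ne']
    field_simp
  have hf' : ∀ r ∈ Ioi (0 : ℝ),
      r ^ (D + 1 - 1) * Real.log r * Real.exp (-r) = r ^ n * f r := fun r hr => by
    rw [← hpow r hr]; simp only [hf]; ring
  have hg' : ∀ r ∈ Ioi (0 : ℝ), Real.exp (-r) * r ^ (D + 1 - 1) = r ^ n * g r := fun r hr => by
    rw [← hpow r hr]; simp only [hg]; ring
  obtain ⟨hlog, hlog'⟩ :=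
    integrableOn_rpow_mul_log_mul_exp_and_integral_eq (s := D + 1) (by linarith)
  have hfi : Integrable f (radialMeasure n) :=
    integrable_radialMeasure.2 ((integrableOn_congr_fun hf' measurableSet_Ioi).1 hlog)
  have hgi : Integrable g (radialMeasure n) :=
    integrable_radialMeasure.2 ((integrableOn_congr_fun hg' measurableSet_Ioi).1
      (Real.GammaIntegral_convergent (by linarith)))
  have hfe : ∫ r, f r ∂(radialMeasure n) = deriv Real.Gamma (D + 1) := by
    rw [integral_radialMeasure, ← hlog', setIntegral_congr_fun measurableSet_Ioi hf']
  have hge : ∫ r, g r ∂(radialMeasure n) = Real.Gamma (D + 1) := by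
    rw [integral_radialMeasure, Real.Gamma_eq_integral (by linarith),
      setIntegral_congr_fun measurableSet_Ioi hg']
  have hVi : Integrable V (volume.restrict (simplexDom (n + 1))) := integrableOn_Vdens hθ ha
  have hWi : Integrable W (volume.restrict (simplexDom (n + 1))) :=
    integrableOn_sum_mul_log_mul_Vdens hθ ha
  refine (integral_orthant n
    ((measurable_sum_mul_log _).mul (measurable_hWeight (n + 1) θ a))).trans ?_
  refine (integral_congr_ae (g := fun p : ℝ × (Fin n → ℝ) =>
    f p.1 * V p.2 + g p.1 * W p.2) ?_).trans ?_
  · filter_upwards [ae_prod_pos_and_mem n] with p hp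
    rw [Pi.mul_apply, sum_smul_mul_log hp.1 (sum_simplexExt n p.2), hWeight_coneMap hp.1 hp.2]
    simp only [hf, hg, hV, hW, hD]
    ring
  rw [integral_add (hfi.mul_prod hVi) (hgi.mul_prod hWi), integral_prod_mul, integral_prod_mul,
    hfe, hge]
  rfl

/-- **First-moment relation for the von Neumann entropy.** For every integer
`m ≥ 1` and reals `θ > 0`, `a > −1`, with `d = m(mθ−θ+2a+2)/2`:
`E_f[−Σ λ_i ln λ_i] = ψ₀(d+1) − (1/d) · E_h[Σ x_i ln x_i]`
(the summand `t ln t` is `0` at `t = 0`, as is `Real.log 0 = 0`). -/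
theorem vonNeumann_moment_relation (m : ℕ) (hm : 1 ≤ m) (θ a : ℝ)
    (hθ : 0 < θ) (ha : -1 < a) :
    Ef m θ a (fun lam => -∑ i, lam i * Real.log (lam i))
      = psi0 (dPar m θ a + 1)
        - 1 / dPar m θ a * Eh m θ a (fun x => ∑ i, x i * Real.log (x i)) := by
  obtain ⟨n, rfl⟩ : ∃ n, m = n + 1 := ⟨m - 1, by omega⟩
  have hD := dPar_pos hm hθ ha
  have hZ := integral_Vdens_ne_zero (n := n) hθ ha
  have hΓ := (Real.Gamma_pos_of_pos hD).ne'
  rw [Ef, Eh, integral_hWeight_eq hθ ha, integral_sum_mul_log_mul_hWeight_eq hθ ha, psi0,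
    Real.Gamma_add_one hD.ne']
  simp only [neg_mul]
  rw [integral_neg]
  field_simp
  ring

end
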